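/- The complete graph K₅ does not embed topologically into the plane ℝ². -/

import Mathlib

open Set

noncomputable section

/-- The point of `ℝ^V` corresponding to a vertex `v` of a graph. -/
def vert {V : Type*} [DecidableEq V] (v : V) : V → ℝ := fun i => if i = v then 1 else 0

/-- Geometric realization of a simple graph as a subset of `ℝ^V`:
the union of the straight segments joining the standard points of adjacent vertices. -/
def graphRealization {V : Type*} [DecidableEq V] (G : SimpleGraph V) : Set (V → ℝ) :=
  ⋃ p : {p : V × V // G.Adj p.1 p.2}, segment ℝ (vert p.1.1) (vert p.1.2)

/-- A (compact) polyhedron: a finite union of polytopes (convex hulls of finite sets). -/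
def IsPolyhedron {E : Type*} [AddCommGroup E] [Module ℝ E] (s : Set E) : Prop :=
  ∃ T : Set (Set E), T.Finite ∧ (∀ P ∈ T, ∃ Q : Set E, Q.Finite ∧ P = convexHull ℝ Q) ∧
    s = ⋃₀ T

/-- `f` is piecewise linear (PL) on `s`: there is a finite family of polytopes covering `s`
on each of which `f` coincides with an affine map. -/
def IsPLOn {E F : Type*} [AddCommGroup E] [Module ℝ E] [AddCommGroup F] [Module ℝ F]
    (f : E → F) (s : Set E) : Prop :=
  ∃ T : Set (Set E), T.Finite ∧ (∀ P ∈ T, ∃ Q : Set E, Q.Finite ∧ P = convexHull ℝ Q) ∧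
    s ⊆ ⋃₀ T ∧ ∀ P ∈ T, ∃ g : E →ᵃ[ℝ] F, EqOn f g (P ∩ s)

/-- The cone over a set `A` with apex `p` (union of segments from `p` to points of `A`). -/
def coneFrom {E : Type*} [AddCommGroup E] [Module ℝ E] (p : E) (A : Set E) : Set E :=
  ⋃ x ∈ A, segment ℝ p x

/-- A nowhere vanishing continuous function on a simply connected, locally path connected space has
a continuous logarithm. -/
theorem exists_continuous_log {X : Type*} [TopologicalSpace X] [SimplyConnectedSpace X]
    [LocallyPathConnectedSpace X] {g : X → ℂ} (hg : Continuous g) (h0 : ∀ x, g x ≠ 0) :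
    ∃ L : X → ℂ, Continuous L ∧ ∀ x, Complex.exp (L x) = g x := by
  obtain ⟨x₀⟩ : Nonempty X := inferInstance
  obtain ⟨L, ⟨-, hL⟩, -⟩ := Complex.isCoveringMapOn_exp.existsUnique_continuousMap_lifts
    ⟨g, hg⟩ (a₀ := x₀) (Complex.exp_log (h0 x₀)) h0
  exact ⟨L, L.continuous, fun x => congrFun hL x⟩

/-- Continuous logarithms of proportional functions have the same increments. -/
theorem log_increment_eq {X : Type*} [TopologicalSpace X] [PreconnectedSpace X] {L M : X → ℂ}
    (hL : Continuous L) (hM : Continuous M) {c : ℂ}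
    (h : ∀ x, Complex.exp (L x) = c * Complex.exp (M x)) (x y : X) :
    L y - L x = M y - M x := by
  have key : L = fun z => M z + (L x - M x) := by
    refine Complex.isCoveringMap_exp.eq_of_comp_eq hL (by fun_prop) ?_ x (by ring)
    funext z
    refine Subtype.ext ?_
    have hx : Complex.exp (L x - M x) = c := by
      rw [Complex.exp_sub, h x, mul_div_cancel_right₀ _ (Complex.exp_ne_zero _)]
    simp only [Function.comp_apply, Complex.exp_add, hx, h z]
    ring
  have := congrFun key y
  rw [this]
  ring

/-- The increment over `[0, 1]` of a continuous logarithm of `p - z` (zero if there is none). -/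
def logIncrement (p : ℝ → ℂ) (z : ℂ) : ℂ :=
  open Classical in
  if h : ∃ L : ℝ → ℂ, Continuous L ∧ ∀ s, Complex.exp (L s) = p s - z then
    h.choose 1 - h.choose 0
  else 0

theorem logIncrement_eq {p L : ℝ → ℂ} {z c : ℂ} (hc : c ≠ 0) (hL : Continuous L)
    (h : ∀ s, Complex.exp (L s) = c * (p s - z)) : logIncrement p z = L 1 - L 0 := by
  have hex : ∃ M : ℝ → ℂ, Continuous M ∧ ∀ s, Complex.exp (M s) = p s - z :=
    ⟨fun s => L s - Complex.log c, by fun_prop, fun s => by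
      rw [Complex.exp_sub, h, Complex.exp_log hc, mul_div_cancel_left₀ _ hc]⟩
  rw [logIncrement, dif_pos hex]
  refine (log_increment_eq hL hex.choose_spec.1 (c := c) (fun s => ?_) 0 1).symm
  rw [h, hex.choose_spec.2]

/-- The total increment of `log (p - q)` along the boundary of the unit square vanishes. -/
theorem logIncrement_square {p q : ℝ → ℂ} (hp : Continuous p) (hq : Continuous q)
    (hpq : ∀ s t, p s ≠ q t) :
    logIncrement p (q 0) + logIncrement q (p 1) - logIncrement p (q 1) - logIncrement q (p 0)
      = 0 := by
  obtain ⟨L, hL, hexp⟩ := exists_continuous_log (X := ℝ × ℝ) (g := fun x => p x.1 - q x.2)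
    (by fun_prop) (fun x => sub_ne_zero.2 (hpq _ _))
  have h1 (t : ℝ) : logIncrement p (q t) = L (1, t) - L (0, t) :=
    logIncrement_eq (L := fun s => L (s, t)) one_ne_zero (by fun_prop) (by simp [hexp])
  have h2 (s : ℝ) : logIncrement q (p s) = L (s, 1) - L (s, 0) :=
    logIncrement_eq (L := fun t => L (s, t)) (c := -1) (by simp) (by fun_prop) (by simp [hexp])
  rw [h1, h1, h2, h2]
  ring

/-- The exponential of `logIncrement` is the ratio of the end values. -/
theorem exp_logIncrement {p : ℝ → ℂ} {z : ℂ} (hp : Continuous p) (h : ∀ s, p s ≠ z) :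
    Complex.exp (logIncrement p z) = (p 1 - z) / (p 0 - z) := by
  obtain ⟨L, hL, hexp⟩ := exists_continuous_log (g := fun s => p s - z)
    (by fun_prop) (fun s => sub_ne_zero.2 (h s))
  rw [logIncrement_eq one_ne_zero hL (by simp [hexp]), Complex.exp_sub, hexp, hexp]

/-- A choice of logarithm of `F y - F x` for which exchanging `x < y` adds `π i`. -/
def dirLog {V : Type*} [LinearOrder V] (F : V → ℂ) (x y : V) : ℂ :=
  if x < y then Complex.log (F y - F x) else Complex.log (F x - F y) + Real.pi * Complex.I

theorem exp_dirLog {V : Type*} [LinearOrder V] {F : V → ℂ} {x y : V} (h : F x ≠ F y) :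
    Complex.exp (dirLog F x y) = F y - F x := by
  unfold dirLog
  split_ifs
  · exact Complex.exp_log (sub_ne_zero.2 h.symm)
  · rw [Complex.exp_add, Complex.exp_log (sub_ne_zero.2 h), Complex.exp_pi_mul_I]
    ring

theorem dirLog_swap {V : Type*} [LinearOrder V] (F : V → ℂ) {x y : V} (h : x ≠ y) :
    dirLog F y x - dirLog F x y = ((if x < y then 1 else -1 : ℤ) : ℂ) * (Real.pi * Complex.I) := by
  unfold dirLog
  rcases h.lt_or_gt with h | h <;> simp [h, h.not_gt]

/-- There is no drawing of the complete graph on five vertices in `ℂ` in which disjoint edges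
have disjoint images. -/
theorem false_of_disjoint_edges (F : Fin 5 → ℂ) (γ : Fin 5 → Fin 5 → ℝ → ℂ)
    (hγ : ∀ a b, Continuous (γ a b)) (h0 : ∀ a b, γ a b 0 = F a) (h1 : ∀ a b, γ a b 1 = F b)
    (hF : ∀ c a b, c ≠ a → c ≠ b → ∀ s, γ a b s ≠ F c)
    (hd : ∀ a b c d, a ≠ c → a ≠ d → b ≠ c → b ≠ d → ∀ s t, γ a b s ≠ γ c d t) : False := by
  have hinj (a b : Fin 5) (h : a ≠ b) : F a ≠ F b := fun hab =>
    hF b a a h.symm h.symm 0 ((h0 a a).trans hab)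
  have hturn (v a b : Fin 5) : ∃ n : ℤ, v ≠ a → v ≠ b → logIncrement (γ a b) (F v) =
      dirLog F v b - dirLog F v a + n * (2 * Real.pi * Complex.I) := by
    by_cases h : v ≠ a ∧ v ≠ b
    · obtain ⟨n, hn⟩ := Complex.exp_eq_exp_iff_exists_int.1
        (show Complex.exp (logIncrement (γ a b) (F v)) =
          Complex.exp (dirLog F v b - dirLog F v a) by
        rw [exp_logIncrement (hγ a b) (hF v a b h.1 h.2), h0, h1, Complex.exp_sub,
          exp_dirLog (hinj _ _ h.1), exp_dirLog (hinj _ _ h.2)])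
      exact ⟨n, fun _ _ => hn⟩
    · exact ⟨0, fun ha hb => absurd ⟨ha, hb⟩ h⟩
  choose n hn using hturn
  have rel (a b c d : Fin 5) (hac : a ≠ c) (had : a ≠ d) (hbc : b ≠ c) (hbd : b ≠ d) :
      2 * (n c a b + n b c d - n d a b - n a c d) + (if b < c then 1 else -1)
        - (if a < c then 1 else -1) - (if b < d then 1 else -1) + (if a < d then 1 else -1)
        = (0 : ℤ) := by
    have hsq := logIncrement_square (hγ a b) (hγ c d) (hd a b c d hac had hbc hbd)
    rw [h0, h0, h1, h1, hn c a b hac.symm hbc.symm, hn b c d hbc hbd, hn d a b had.symm hbd.symm,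
      hn a c d hac had] at hsq
    have hpi : (Real.pi * Complex.I : ℂ) ≠ 0 :=
      mul_ne_zero (mod_cast Real.pi_ne_zero) Complex.I_ne_zero
    rw [← Int.cast_inj (α := ℂ), ← mul_left_inj' hpi]
    push_cast [-Int.cast_ite]
    linear_combination hsq - dirLog_swap F hbc + dirLog_swap F hac + dirLog_swap F hbd
      - dirLog_swap F had
  have e1 := rel 0 1 2 3 (by decide) (by decide) (by decide) (by decide)
  have e2 := rel 0 2 1 3 (by decide) (by decide) (by decide) (by decide)
  have e3 := rel 0 3 1 2 (by decide) (by decide) (by decide) (by decide)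
  have e4 := rel 0 1 2 4 (by decide) (by decide) (by decide) (by decide)
  have e5 := rel 0 2 1 4 (by decide) (by decide) (by decide) (by decide)
  have e6 := rel 0 4 1 2 (by decide) (by decide) (by decide) (by decide)
  have e7 := rel 0 1 3 4 (by decide) (by decide) (by decide) (by decide)
  have e8 := rel 0 3 1 4 (by decide) (by decide) (by decide) (by decide)
  have e9 := rel 0 4 1 3 (by decide) (by decide) (by decide) (by decide)
  have e10 := rel 0 2 3 4 (by decide) (by decide) (by decide) (by decide)
  have e11 := rel 0 3 2 4 (by decide) (by decide) (by decide) (by decide)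
  have e12 := rel 0 4 2 3 (by decide) (by decide) (by decide) (by decide)
  have e13 := rel 1 2 3 4 (by decide) (by decide) (by decide) (by decide)
  have e14 := rel 1 3 2 4 (by decide) (by decide) (by decide) (by decide)
  have e15 := rel 1 4 2 3 (by decide) (by decide) (by decide) (by decide)
  simp (decide := true) only [if_true, if_false]
    at e1 e2 e3 e4 e5 e6 e7 e8 e9 e10 e11 e12 e13 e14 e15
  omega

theorem segment_subset_graphRealization_top {V : Type*} [DecidableEq V] [Nontrivial V] (a b : V) :
    segment ℝ (vert a) (vert b) ⊆ graphRealization (⊤ : SimpleGraph V) := by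
  rcases eq_or_ne a b with rfl | h
  · obtain ⟨b, hb⟩ := exists_ne a
    rw [segment_same, singleton_subset_iff]
    exact mem_iUnion.2 ⟨⟨(a, b), hb.symm⟩, left_mem_segment ℝ _ _⟩
  · exact subset_iUnion (fun p : {p : V × V // (⊤ : SimpleGraph V).Adj p.1 p.2} =>
      segment ℝ (vert p.1.1) (vert p.1.2)) ⟨(a, b), h⟩

/-- Segments between disjoint pairs of standard points are disjoint. -/
theorem lineMap_vert_ne {V : Type*} [DecidableEq V] {a b c d : V} (hac : a ≠ c) (had : a ≠ d)
    (hbc : b ≠ c) (hbd : b ≠ d) (s t : ℝ) :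
    AffineMap.lineMap (vert a) (vert b) s ≠ AffineMap.lineMap (vert c) (vert d) t := by
  intro h
  have ha := congrFun h a
  have hb := congrFun h b
  simp only [AffineMap.lineMap_apply_module, vert, Pi.add_apply, Pi.smul_apply, smul_eq_mul,
    hac, had, hbc, hbd, if_false, if_true] at ha hb
  rcases eq_or_ne a b with rfl | hab
  · simp at ha
  · simp only [hab, hab.symm, if_false] at ha hb
    linarith

/-- The complete graph `K₅` does not embed topologically into the plane `ℝ²`. -/
theorem K5_not_planar :
    ¬ ∃ f : ↥(graphRealization (⊤ : SimpleGraph (Fin 5))) → EuclideanSpace ℝ (Fin 2),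
      Continuous f ∧ Function.Injective f := by
  rintro ⟨f, hf, hinj⟩
  let e : EuclideanSpace ℝ (Fin 2) ≃ₗᵢ[ℝ] ℂ := Complex.orthonormalBasisOneI.repr.symm
  let σ (a b : Fin 5) (s : ℝ) : graphRealization (⊤ : SimpleGraph (Fin 5)) :=
    ⟨AffineMap.lineMap (vert a) (vert b) (projIcc (0 : ℝ) 1 zero_le_one s : ℝ),
      segment_subset_graphRealization_top a b (by
        rw [segment_eq_image_lineMap]
        exact mem_image_of_mem _ (projIcc (0 : ℝ) 1 zero_le_one s).2)⟩
  have hσ (a b) : Continuous (σ a b) := by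
    refine Continuous.subtype_mk ?_ _
    exact AffineMap.lineMap_continuous.comp (continuous_subtype_val.comp continuous_projIcc)
  have hd (a b c d : Fin 5) (hac : a ≠ c) (had : a ≠ d) (hbc : b ≠ c) (hbd : b ≠ d) (s t : ℝ) :
      e (f (σ a b s)) ≠ e (f (σ c d t)) := fun h =>
    lineMap_vert_ne hac had hbc hbd _ _ (congrArg Subtype.val (hinj (e.injective h)))
  have h0 (a b) : σ a b 0 = σ a a 0 := Subtype.ext (by simp [σ])
  have h1 (a b) : σ a b 1 = σ b b 0 := Subtype.ext (by simp [σ])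
  refine false_of_disjoint_edges (fun a => e (f (σ a a 0))) (fun a b s => e (f (σ a b s)))
    (fun a b => e.continuous.comp (hf.comp (hσ a b))) (fun a b => by simp only [h0 a b])
    (fun a b => by simp only [h1 a b]) (fun c a b hca hcb s => ?_) hd
  exact hd a b c c hca.symm hca.symm hcb.symm hcb.symm s 0
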